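/- For the right integral μ of U and the ribbon element r_U ∈ U (the unique element of U with ι(r_U) = r in D), one has μ(r_U) = δ and μ(r_U⁻¹) = δ⁻¹, where δ = ((1−i)/√2)·exp(iπ(3−p²)/(2p)). -/

import Mathlib

open scoped TensorProduct
open Finset

noncomputable section

namespace LogHennings

/-- `q = exp(iπ/p)`. -/
def qq (p : ℕ) : ℂ := Complex.exp ((Real.pi : ℂ) * Complex.I / (p : ℂ))

/-- `q^{1/2} = exp(iπ/(2p))`. -/
def qh (p : ℕ) : ℂ := Complex.exp ((Real.pi : ℂ) * Complex.I / (2 * (p : ℂ)))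

/-- quantum integer `[m] = (q^m - q^{-m})/(q - q⁻¹)`. -/
def qnum (p m : ℕ) : ℂ := ((qq p) ^ m - (qq p)⁻¹ ^ m) / (qq p - (qq p)⁻¹)

/-- quantum factorial `[m]! = [m][m-1]⋯[1]`. -/
def qfac (p : ℕ) : ℕ → ℂ
  | 0 => 1
  | m + 1 => qnum p (m + 1) * qfac p m

/-- Generators of the restricted quantum group `U`. -/
inductive UGen | E | F | K | Kinv

abbrev FU := FreeAlgebra ℂ UGen

def fE : FU := FreeAlgebra.ι ℂ UGen.E
def fF : FU := FreeAlgebra.ι ℂ UGen.F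
def fK : FU := FreeAlgebra.ι ℂ UGen.K
def fKinv : FU := FreeAlgebra.ι ℂ UGen.Kinv

/-- Defining relations of the restricted quantum group `U`. -/
inductive URel (p : ℕ) : FU → FU → Prop
  | Epow : URel p (fE ^ p) 0
  | Fpow : URel p (fF ^ p) 0
  | Kpow : URel p (fK ^ (2 * p)) 1
  | KKinv : URel p (fK * fKinv) 1
  | KinvK : URel p (fKinv * fK) 1
  | KE : URel p (fK * fE * fKinv) ((qq p) ^ 2 • fE)
  | KF : URel p (fK * fF * fKinv) (((qq p) ^ 2)⁻¹ • fF)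
  | EF : URel p (fE * fF - fF * fE) ((qq p - (qq p)⁻¹)⁻¹ • (fK - fKinv))

/-- The restricted quantum group `U = \bar U_q(sl2)`. -/
abbrev Uq (p : ℕ) := RingQuot (URel p)

def UE (p : ℕ) : Uq p := RingQuot.mkAlgHom ℂ (URel p) fE
def UF (p : ℕ) : Uq p := RingQuot.mkAlgHom ℂ (URel p) fF
def UK (p : ℕ) : Uq p := RingQuot.mkAlgHom ℂ (URel p) fK
def UKinv (p : ℕ) : Uq p := RingQuot.mkAlgHom ℂ (URel p) fKinv

/-- Generators of the braided extension `D`. -/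
inductive DGen | e | phi | k | kinv

abbrev FD := FreeAlgebra ℂ DGen

def fe : FD := FreeAlgebra.ι ℂ DGen.e
def fphi : FD := FreeAlgebra.ι ℂ DGen.phi
def fk : FD := FreeAlgebra.ι ℂ DGen.k
def fkinv : FD := FreeAlgebra.ι ℂ DGen.kinv

/-- Defining relations of `D`. -/
inductive DRel (p : ℕ) : FD → FD → Prop
  | epow : DRel p (fe ^ p) 0
  | phipow : DRel p (fphi ^ p) 0
  | kpow : DRel p (fk ^ (4 * p)) 1
  | kkinv : DRel p (fk * fkinv) 1
  | kinvk : DRel p (fkinv * fk) 1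
  | ke : DRel p (fk * fe * fkinv) (qq p • fe)
  | kphi : DRel p (fk * fphi * fkinv) ((qq p)⁻¹ • fphi)
  | ephi : DRel p (fe * fphi - fphi * fe)
      ((qq p - (qq p)⁻¹)⁻¹ • (fk ^ 2 - fkinv ^ 2))

/-- The braided extension `D` of `U`. -/
abbrev Dq (p : ℕ) := RingQuot (DRel p)

def De (p : ℕ) : Dq p := RingQuot.mkAlgHom ℂ (DRel p) fe
def Dphi (p : ℕ) : Dq p := RingQuot.mkAlgHom ℂ (DRel p) fphi
def Dk (p : ℕ) : Dq p := RingQuot.mkAlgHom ℂ (DRel p) fk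
def Dkinv (p : ℕ) : Dq p := RingQuot.mkAlgHom ℂ (DRel p) fkinv

/-- The `R`-matrix of `D`. -/
def Rmat (p : ℕ) : Dq p ⊗[ℂ] Dq p :=
  ((4 * (p : ℂ))⁻¹) •
    ∑ m ∈ range p, ∑ n ∈ range (4 * p), ∑ j ∈ range (4 * p),
      (((qq p - (qq p)⁻¹) ^ m / qfac p m) *
          (qh p) ^ ((m : ℤ) * ((m : ℤ) - 1) + 2 * (m : ℤ) * ((n : ℤ) - (j : ℤ))
            - (n : ℤ) * (j : ℤ))) •
        ((De p ^ m * Dk p ^ n) ⊗ₜ[ℂ] (Dphi p ^ m * Dk p ^ j))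

/-- `R₂₁ = τ(R)`. -/
def R21 (p : ℕ) : Dq p ⊗[ℂ] Dq p := TensorProduct.comm ℂ (Dq p) (Dq p) (Rmat p)

/-- The monodromy `M = R₂₁ R`. -/
def Mmat (p : ℕ) : Dq p ⊗[ℂ] Dq p := R21 p * Rmat p

/-- The ribbon element `r ∈ D`. -/
def rib (p : ℕ) : Dq p :=
  ((1 - Complex.I) / (2 * (Real.sqrt p : ℂ))) •
    ∑ m ∈ range p, ∑ j ∈ range (2 * p),
      (((qq p - (qq p)⁻¹) ^ m / qfac p m) *
          (qh p) ^ (-(m : ℤ) + 2 * (m : ℤ) * (j : ℤ) + ((j : ℤ) + (p : ℤ) + 1) ^ 2)) •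
        (Dphi p ^ m * De p ^ m * Dk p ^ (2 * j))

/-- The Drinfeld element `u = Σ S(β_i) α_i` for `R = Σ α_i ⊗ β_i`,
depending on a choice of antipode `S`. -/
def drinfeldU (p : ℕ) (S : Dq p →ₗ[ℂ] Dq p) : Dq p :=
  LinearMap.mul' ℂ (Dq p) (TensorProduct.map S LinearMap.id (R21 p))

/-- `Δ` takes the prescribed values on the generators of `U`. -/
def IsDeltaU (p : ℕ) (Δ : Uq p →ₐ[ℂ] Uq p ⊗[ℂ] Uq p) : Prop :=
  Δ (UE p) = 1 ⊗ₜ[ℂ] UE p + UE p ⊗ₜ[ℂ] UK p ∧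
  Δ (UF p) = UKinv p ⊗ₜ[ℂ] UF p + UF p ⊗ₜ[ℂ] 1 ∧
  Δ (UK p) = UK p ⊗ₜ[ℂ] UK p ∧
  Δ (UKinv p) = UKinv p ⊗ₜ[ℂ] UKinv p

/-- `ε` takes the prescribed values on the generators of `U`. -/
def IsCounitU (p : ℕ) (ε : Uq p →ₐ[ℂ] ℂ) : Prop :=
  ε (UE p) = 0 ∧ ε (UF p) = 0 ∧ ε (UK p) = 1 ∧ ε (UKinv p) = 1

/-- `S` is an algebra anti-homomorphism taking the prescribed values on the
generators of `U`. -/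
def IsAntipodeU (p : ℕ) (S : Uq p →ₗ[ℂ] Uq p) : Prop :=
  S 1 = 1 ∧ (∀ x y, S (x * y) = S y * S x) ∧
  S (UE p) = -(UE p * UKinv p) ∧ S (UF p) = -(UK p * UF p) ∧
  S (UK p) = UKinv p ∧ S (UKinv p) = UK p

/-- `Δ` takes the prescribed values on the generators of `D`. -/
def IsDeltaD (p : ℕ) (Δ : Dq p →ₐ[ℂ] Dq p ⊗[ℂ] Dq p) : Prop :=
  Δ (De p) = 1 ⊗ₜ[ℂ] De p + De p ⊗ₜ[ℂ] (Dk p ^ 2) ∧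
  Δ (Dphi p) = (Dkinv p ^ 2) ⊗ₜ[ℂ] Dphi p + Dphi p ⊗ₜ[ℂ] 1 ∧
  Δ (Dk p) = Dk p ⊗ₜ[ℂ] Dk p ∧
  Δ (Dkinv p) = Dkinv p ⊗ₜ[ℂ] Dkinv p

/-- `ε` takes the prescribed values on the generators of `D`. -/
def IsCounitD (p : ℕ) (ε : Dq p →ₐ[ℂ] ℂ) : Prop :=
  ε (De p) = 0 ∧ ε (Dphi p) = 0 ∧ ε (Dk p) = 1 ∧ ε (Dkinv p) = 1

/-- `S` is an algebra anti-homomorphism taking the prescribed values on the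
generators of `D`. -/
def IsAntipodeD (p : ℕ) (S : Dq p →ₗ[ℂ] Dq p) : Prop :=
  S 1 = 1 ∧ (∀ x y, S (x * y) = S y * S x) ∧
  S (De p) = -(De p * Dkinv p ^ 2) ∧ S (Dphi p) = -(Dk p ^ 2 * Dphi p) ∧
  S (Dk p) = Dkinv p ∧ S (Dkinv p) = Dk p

/-- `ι` takes the prescribed values `E ↦ e`, `F ↦ φ`, `K^{±1} ↦ k^{±2}`. -/
def IsIota (p : ℕ) (ι : Uq p →ₐ[ℂ] Dq p) : Prop :=
  ι (UE p) = De p ∧ ι (UF p) = Dphi p ∧ ι (UK p) = Dk p ^ 2 ∧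
  ι (UKinv p) = Dkinv p ^ 2

/-- `μ` takes the prescribed values on the PBW basis of `U`. -/
def IsMu (p : ℕ) (μ : Uq p →ₗ[ℂ] ℂ) : Prop :=
  ∀ m n l : ℕ, m < p → n < p → l < 2 * p →
    μ (UE p ^ m * UF p ^ n * UK p ^ l) =
      if m = p - 1 ∧ n = p - 1 ∧ l = p + 1 then
        -((Real.sqrt (2 / (p : ℝ)) : ℂ)) * (qfac p (p - 1)) ^ 2
      else 0

variable {A : Type*} [Ring A] [Algebra ℂ A]

/-- Coassociativity of a comultiplication. -/
def Coassoc (Δ : A →ₐ[ℂ] A ⊗[ℂ] A) : Prop :=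
  ∀ x, TensorProduct.assoc ℂ A A A
      (TensorProduct.map Δ.toLinearMap LinearMap.id (Δ x)) =
    TensorProduct.map LinearMap.id Δ.toLinearMap (Δ x)

/-- The counit axiom. -/
def CounitAxiom (Δ : A →ₐ[ℂ] A ⊗[ℂ] A) (ε : A →ₐ[ℂ] ℂ) : Prop :=
  (∀ x, TensorProduct.lid ℂ A
      (TensorProduct.map ε.toLinearMap LinearMap.id (Δ x)) = x) ∧
  (∀ x, TensorProduct.rid ℂ A
      (TensorProduct.map LinearMap.id ε.toLinearMap (Δ x)) = x)

/-- The antipode axiom. -/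
def AntipodeAxiom (Δ : A →ₐ[ℂ] A ⊗[ℂ] A) (ε : A →ₐ[ℂ] ℂ)
    (S : A →ₗ[ℂ] A) : Prop :=
  (∀ x, LinearMap.mul' ℂ A (TensorProduct.map S LinearMap.id (Δ x)) = ε x • 1) ∧
  (∀ x, LinearMap.mul' ℂ A (TensorProduct.map LinearMap.id S (Δ x)) = ε x • 1)

/-- `x ↦ x ⊗ 1`. -/
def e1 (p : ℕ) : Dq p →ₗ[ℂ] Dq p ⊗[ℂ] Dq p :=
  (TensorProduct.mk ℂ (Dq p) (Dq p)).flip 1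

/-- `x ↦ 1 ⊗ x`. -/
def e2 (p : ℕ) : Dq p →ₗ[ℂ] Dq p ⊗[ℂ] Dq p :=
  TensorProduct.mk ℂ (Dq p) (Dq p) 1

/-- The balancing element `g = K^{p+1}`. -/
def gU (p : ℕ) : Uq p := UK p ^ (p + 1)

/-- The span of commutators `[U,U]`. -/
def commSpan (p : ℕ) : Submodule ℂ (Uq p) :=
  Submodule.span ℂ {z : Uq p | ∃ x y : Uq p, z = x * y - y * x}

end LogHennings
namespace LogHennings

/-- Abstract form of the quantum group relations. -/
structure QRel {A : Type*} [Ring A] [Algebra ℂ A] (q : ℂ) (E F K Ki : A) : Prop where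
  KKi : K * Ki = 1
  KiK : Ki * K = 1
  KE : K * E = q ^ 2 • (E * K)
  KF : K * F = (q ^ 2)⁻¹ • (F * K)
  KiE : Ki * E = (q ^ 2)⁻¹ • (E * Ki)
  KiF : Ki * F = q ^ 2 • (F * Ki)
  EF : E * F = F * E + (q - q⁻¹)⁻¹ • (K - Ki)

section
variable {A : Type*} [Ring A] [Algebra ℂ A] {q : ℂ} {E F K Ki : A}

theorem QRel.swap (h : QRel q E F K Ki) : QRel q F E Ki K where
  KKi := h.KiK
  KiK := h.KKi
  KE := h.KiF
  KF := h.KiE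
  KiE := h.KF
  KiF := h.KE
  EF := by
    rw [h.EF, add_assoc, ← smul_add]; simp

theorem QRel.EFpow (h : QRel q E F K Ki) (hq : q ≠ 0) (hq1 : q - q⁻¹ ≠ 0) (m : ℕ) :
    E * F ^ (m + 1) = F ^ (m + 1) * E +
      ((q ^ (m + 1) - q⁻¹ ^ (m + 1)) / (q - q⁻¹) / (q - q⁻¹)) •
        (F ^ m * (q⁻¹ ^ m • K - q ^ m • Ki)) := by
  induction m with
  | zero =>
    simp only [zero_add, pow_one, pow_zero, one_smul, one_mul]
    rw [h.EF, div_self hq1, one_div]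
  | succ m ih =>
    rw [pow_succ F (m + 1), ← mul_assoc, ih, add_mul, mul_assoc _ E F, h.EF, smul_mul_assoc,
      mul_assoc (F ^ m), sub_mul, smul_mul_assoc, smul_mul_assoc, h.KF, h.KiF]
    simp only [mul_add, mul_sub, mul_smul_comm, smul_sub, pow_succ F, mul_assoc, smul_smul]
    have e1 : (q ^ (m + 1 + 1) - q⁻¹ ^ (m + 1 + 1)) / (q - q⁻¹) / (q - q⁻¹) * q⁻¹ ^ (m + 1)
        = (q - q⁻¹)⁻¹ +
        (q ^ (m + 1) - q⁻¹ ^ (m + 1)) / (q - q⁻¹) / (q - q⁻¹) * (q⁻¹ ^ m * (q ^ 2)⁻¹) := by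
      simp only [inv_pow]
      have h0 : q ^ 2 - 1 ≠ 0 := by
        intro h0
        apply hq1
        have : q - q⁻¹ = (q ^ 2 - 1) / q := by field_simp
        rw [this, h0, zero_div]
      field_simp
      ring
    have e2 : (q ^ (m + 1 + 1) - q⁻¹ ^ (m + 1 + 1)) / (q - q⁻¹) / (q - q⁻¹) * q ^ (m + 1)
        = (q - q⁻¹)⁻¹ +
        (q ^ (m + 1) - q⁻¹ ^ (m + 1)) / (q - q⁻¹) / (q - q⁻¹) * (q ^ m * q ^ 2) := by
      simp only [inv_pow]
      have h0 : q ^ 2 - 1 ≠ 0 := by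
        intro h0
        apply hq1
        have : q - q⁻¹ = (q ^ 2 - 1) / q := by field_simp
        rw [this, h0, zero_div]
      field_simp
      ring
    rw [e1, e2]
    simp only [add_smul]
    abel

theorem QRel.Kpow_comm (h : QRel q E F K Ki) (m : ℕ) :
    K * E ^ m = (q ^ 2) ^ m • (E ^ m * K) := by
  induction m with
  | zero => simp
  | succ m ih =>
    rw [pow_succ, ← mul_assoc, ih, smul_mul_assoc, mul_assoc, h.KE, mul_smul_comm, smul_smul,
      mul_assoc, pow_succ (q ^ 2)]

theorem QRel.FEsucc (h : QRel q E F K Ki) (hq : q ≠ 0) (hq1 : q - q⁻¹ ≠ 0) (m : ℕ) :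
    ∃ a b : ℂ, E ^ (m + 1) * F ^ (m + 1) = E ^ m * F ^ m * (E * F + a • K + b • Ki) := by
  cases m with
  | zero => exact ⟨0, 0, by simp⟩
  | succ m =>
    have h1 := h.EFpow hq hq1 m
    set c := (q ^ (m + 1) - q⁻¹ ^ (m + 1)) / (q - q⁻¹) / (q - q⁻¹)
    refine ⟨c * (q⁻¹ ^ m * (q ^ 2)⁻¹), -(c * (q ^ m * q ^ 2)), ?_⟩
    have h2 : E ^ (m + 1 + 1) * F ^ (m + 1 + 1) = E ^ (m + 1) * (E * F ^ (m + 1)) * F := by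
      rw [pow_succ E, pow_succ F (m+1)]; noncomm_ring
    rw [h2, h1]
    simp only [mul_add, add_mul, mul_assoc, smul_mul_assoc, mul_smul_comm, sub_mul, mul_sub,
      h.KF, h.KiF, smul_sub, smul_smul, pow_succ F]
    rw [neg_smul]
    abel

/-- Span of lower monomials. -/
def lowSpan (E F K : A) (m : ℕ) : Submodule ℂ A :=
  Submodule.span ℂ {z | ∃ a l : ℕ, a < m ∧ z = E ^ a * F ^ a * K ^ l}

theorem lowSpan_mulK {m : ℕ} {x : A} (hx : x ∈ lowSpan E F K m) (j : ℕ) :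
    x * K ^ j ∈ lowSpan E F K m := by
  unfold lowSpan at hx
  induction hx using Submodule.span_induction with
  | mem x h =>
    obtain ⟨a, l, ha, rfl⟩ := h
    refine Submodule.subset_span ⟨a, l + j, ha, ?_⟩
    rw [pow_add]; noncomm_ring
  | zero => simp
  | add x y _ _ hx hy => rw [add_mul]; exact add_mem hx hy
  | smul c x _ hx => rw [smul_mul_assoc]; exact Submodule.smul_mem _ _ hx

theorem lowSpan_mono {m m' : ℕ} (hm : m ≤ m') {x : A} (hx : x ∈ lowSpan E F K m) :
    x ∈ lowSpan E F K m' := by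
  refine Submodule.span_mono ?_ hx
  rintro z ⟨a, l, ha, rfl⟩
  exact ⟨a, l, by omega, rfl⟩

theorem QRel.K_EF (h : QRel q E F K Ki) (hq : q ≠ 0) : Commute K (E * F) := by
  unfold Commute SemiconjBy
  rw [← mul_assoc, h.KE, smul_mul_assoc, mul_assoc, h.KF, mul_smul_comm, smul_smul,
    mul_inv_cancel₀ (pow_ne_zero _ hq), one_smul, mul_assoc]

theorem QRel.low_EF (h : QRel q E F K Ki) (hq : q ≠ 0) (hq1 : q - q⁻¹ ≠ 0) {N : ℕ}
    (hKi : Ki = K ^ N) {m : ℕ} {x : A} (hx : x ∈ lowSpan E F K m) :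
    x * (E * F) ∈ lowSpan E F K (m + 1) := by
  unfold lowSpan at hx
  induction hx using Submodule.span_induction with
  | mem x hx =>
    obtain ⟨a, l, ha, rfl⟩ := hx
    obtain ⟨u, v, huv⟩ := h.FEsucc hq hq1 a
    have : E ^ a * F ^ a * K ^ l * (E * F) = E ^ (a + 1) * F ^ (a + 1) * K ^ l
        - u • (E ^ a * F ^ a * K ^ (1 + l)) - v • (E ^ a * F ^ a * K ^ (N + l)) := by
      rw [mul_assoc (E ^ a * F ^ a), ((h.K_EF hq).pow_left l).eq, huv, hKi]
      simp only [mul_add, add_mul, pow_add, smul_mul_assoc, mul_smul_comm, mul_assoc, pow_one]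
      abel
    rw [this]
    refine sub_mem (sub_mem ?_ (Submodule.smul_mem _ _ ?_)) (Submodule.smul_mem _ _ ?_)
    · exact Submodule.subset_span ⟨a + 1, l, by omega, rfl⟩
    · exact Submodule.subset_span ⟨a, _, by omega, rfl⟩
    · exact Submodule.subset_span ⟨a, _, by omega, rfl⟩
  | zero => simp
  | add x y _ _ hx hy => rw [add_mul]; exact add_mem hx hy
  | smul c x _ hx => rw [smul_mul_assoc]; exact Submodule.smul_mem _ _ hx

theorem QRel.FE_reorder (h : QRel q E F K Ki) (hq : q ≠ 0) (hq1 : q - q⁻¹ ≠ 0) {N : ℕ}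
    (hKi : Ki = K ^ N) (m : ℕ) :
    F ^ m * E ^ m - E ^ m * F ^ m ∈ lowSpan E F K m := by
  induction m with
  | zero => simp
  | succ m ih =>
    obtain ⟨a, b, h1⟩ := h.swap.FEsucc hq hq1 m
    obtain ⟨a', b', h2⟩ := h.FEsucc hq hq1 m
    set x := F ^ m * E ^ m - E ^ m * F ^ m with hx
    have hx' : F ^ m * E ^ m = E ^ m * F ^ m + x := by rw [hx]; abel
    have hFE : F * E = E * F - (q - q⁻¹)⁻¹ • (K - Ki) := by rw [h.EF]; abel
    have key : F ^ (m + 1) * E ^ (m + 1) - E ^ (m + 1) * F ^ (m + 1)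
        = (b - (q - q⁻¹)⁻¹ - a') • (E ^ m * F ^ m * K ^ 1)
          + (a + (q - q⁻¹)⁻¹ - b') • (E ^ m * F ^ m * K ^ N)
          + x * (E * F) + (b - (q - q⁻¹)⁻¹) • (x * K ^ 1)
          + (a + (q - q⁻¹)⁻¹) • (x * K ^ N) := by
      rw [h1, h2, hx', hFE, ← hKi, pow_one]
      simp only [mul_add, add_mul, mul_sub, smul_sub, mul_smul_comm]
      module
    rw [key]
    refine add_mem (add_mem (add_mem (add_mem ?_ ?_) ?_) ?_) ?_
    · exact Submodule.smul_mem _ _ (Submodule.subset_span ⟨m, _, by omega, rfl⟩)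
    · exact Submodule.smul_mem _ _ (Submodule.subset_span ⟨m, _, by omega, rfl⟩)
    · exact h.low_EF hq hq1 hKi ih
    · exact Submodule.smul_mem _ _ (lowSpan_mono (by omega) (lowSpan_mulK ih _))
    · exact Submodule.smul_mem _ _ (lowSpan_mono (by omega) (lowSpan_mulK ih _))

/-- value of an integral-like functional on `F^m E^m K^j`. -/
theorem QRel.mu_FE (h : QRel q E F K Ki) (hq : q ≠ 0) (hq1 : q - q⁻¹ ≠ 0) {p : ℕ} (hp : 2 ≤ p)
    (hK : K ^ (2 * p) = 1) (μ : A →ₗ[ℂ] ℂ) (z : ℂ)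
    (hμ : ∀ m n l : ℕ, m < p → n < p → l < 2 * p → μ (E ^ m * F ^ n * K ^ l) =
      if m = p - 1 ∧ n = p - 1 ∧ l = p + 1 then z else 0)
    (m j : ℕ) (hm : m < p) (hj : j < 2 * p) :
    μ (F ^ m * E ^ m * K ^ j) = if m = p - 1 ∧ j = p + 1 then z else 0 := by
  have hKi : Ki = K ^ (2 * p - 1) := by
    have h1 : K ^ (2 * p - 1) * K = 1 := by
      rw [← pow_succ, show 2 * p - 1 + 1 = 2 * p by omega, hK]
    calc Ki = K ^ (2 * p - 1) * K * Ki := by rw [h1, one_mul]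
      _ = _ := by rw [mul_assoc, h.KKi, mul_one]
  have hz : ∀ x ∈ lowSpan E F K m, μ x = 0 := by
    intro x hx
    unfold lowSpan at hx
    induction hx using Submodule.span_induction with
    | mem x hx =>
      obtain ⟨a, l, ha, rfl⟩ := hx
      have : K ^ l = K ^ (l % (2 * p)) := by
        conv_lhs => rw [← Nat.div_add_mod l (2 * p), pow_add, pow_mul, hK, one_pow, one_mul]
      rw [this, hμ a a _ (by omega) (by omega) (Nat.mod_lt _ (by omega)), if_neg (by omega)]
    | zero => simp
    | add x y _ _ hx hy => rw [map_add, hx, hy, add_zero]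
    | smul c x _ hx => rw [map_smul, hx, smul_zero]
  have h1 := hz _ (lowSpan_mulK (h.FE_reorder hq hq1 hKi m) j)
  rw [sub_mul, map_sub, sub_eq_zero] at h1
  rw [h1, hμ m m j hm hm hj]
  simp
end
end LogHennings
namespace LogHennings
open Matrix

theorem qq_ne_zero (p : ℕ) : qq p ≠ 0 := Complex.exp_ne_zero _

theorem U_rel (p : ℕ) : QRel (qq p) (UE p) (UF p) (UK p) (UKinv p) ∧
    UE p ^ p = 0 ∧ UF p ^ p = 0 ∧ UK p ^ (2 * p) = 1 := by
  have hq := qq_ne_zero p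
  have r1 := RingQuot.mkAlgHom_rel ℂ (URel.KKinv (p := p))
  have r2 := RingQuot.mkAlgHom_rel ℂ (URel.KinvK (p := p))
  have r3 := RingQuot.mkAlgHom_rel ℂ (URel.KE (p := p))
  have r4 := RingQuot.mkAlgHom_rel ℂ (URel.KF (p := p))
  have r5 := RingQuot.mkAlgHom_rel ℂ (URel.EF (p := p))
  have r6 := RingQuot.mkAlgHom_rel ℂ (URel.Epow (p := p))
  have r7 := RingQuot.mkAlgHom_rel ℂ (URel.Fpow (p := p))
  have r8 := RingQuot.mkAlgHom_rel ℂ (URel.Kpow (p := p))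
  simp only [map_mul, map_one, map_smul, map_sub, map_pow, map_zero] at r1 r2 r3 r4 r5 r6 r7 r8
  change UK p * UKinv p = 1 at r1
  change UKinv p * UK p = 1 at r2
  change UK p * UE p * UKinv p = qq p ^ 2 • UE p at r3
  change UK p * UF p * UKinv p = (qq p ^ 2)⁻¹ • UF p at r4
  change UE p * UF p - UF p * UE p = (qq p - (qq p)⁻¹)⁻¹ • (UK p - UKinv p) at r5
  have hKE : UK p * UE p = qq p ^ 2 • (UE p * UK p) := by
    rw [← smul_mul_assoc, ← r3, mul_assoc _ (UKinv p), r2, mul_one]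
  have hKF : UK p * UF p = (qq p ^ 2)⁻¹ • (UF p * UK p) := by
    rw [← smul_mul_assoc, ← r4, mul_assoc _ (UKinv p), r2, mul_one]
  refine ⟨⟨r1, r2, hKE, hKF, ?_, ?_, ?_⟩, r6, r7, r8⟩
  · have : UE p * UKinv p = qq p ^ 2 • (UKinv p * UE p) := by
      calc UE p * UKinv p = UKinv p * (UK p * UE p * UKinv p) := by
            rw [← mul_assoc, ← mul_assoc, r2, one_mul]
        _ = _ := by rw [r3, mul_smul_comm]
    rw [this, smul_smul, inv_mul_cancel₀ (pow_ne_zero _ hq), one_smul]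
  · have : UF p * UKinv p = (qq p ^ 2)⁻¹ • (UKinv p * UF p) := by
      calc UF p * UKinv p = UKinv p * (UK p * UF p * UKinv p) := by
            rw [← mul_assoc, ← mul_assoc, r2, one_mul]
        _ = _ := by rw [r4, mul_smul_comm]
    rw [this, smul_smul, mul_inv_cancel₀ (pow_ne_zero _ hq), one_smul]
  · rw [← r5]; abel

/-- images of the generators of `D` in two by two matrices over `U`. -/
def dImg (p : ℕ) : DGen → Matrix (Fin 2) (Fin 2) (Uq p)
  | .e => !![UE p, 0; 0, (qq p)⁻¹ • UE p]
  | .phi => !![UF p, 0; 0, (qq p) • UF p]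
  | .k => !![0, UK p; 1, 0]
  | .kinv => !![0, 1; UKinv p, 0]

theorem diag_pow {A : Type*} [Ring A] (a b : A) (n : ℕ) :
    (!![a, 0; 0, b] : Matrix (Fin 2) (Fin 2) A) ^ n = !![a ^ n, 0; 0, b ^ n] := by
  induction n with
  | zero => simp [Matrix.one_fin_two]
  | succ n ih => rw [pow_succ, ih, Matrix.mul_fin_two]; simp [pow_succ]

theorem smul_fin_two' {A : Type*} [SMul ℂ A] (x : ℂ) (a b c d : A) :
    x • (!![a, b; c, d] : Matrix (Fin 2) (Fin 2) A) = !![x • a, x • b; x • c, x • d] := by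
  ext i j; fin_cases i <;> fin_cases j <;> rfl

theorem sub_fin_two' {A : Type*} [Ring A] (a b c d a' b' c' d' : A) :
    (!![a, b; c, d] : Matrix (Fin 2) (Fin 2) A) - !![a', b'; c', d'] =
      !![a - a', b - b'; c - c', d - d'] := by
  ext i j; fin_cases i <;> fin_cases j <;> rfl

theorem exists_DtoMat (p : ℕ) (hp : 2 ≤ p) : ∃ Φ : Dq p →ₐ[ℂ] Matrix (Fin 2) (Fin 2) (Uq p),
    Φ (De p) = dImg p .e ∧ Φ (Dphi p) = dImg p .phi ∧
    Φ (Dk p) = dImg p .k ∧ Φ (Dkinv p) = dImg p .kinv := by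
  obtain ⟨h, hE, hF, hK⟩ := U_rel p
  have hq := qq_ne_zero p
  have hEF' : UE p * UF p - UF p * UE p = (qq p - (qq p)⁻¹)⁻¹ • (UK p - UKinv p) := by
    rw [h.EF]; abel
  have hsq : dImg p .k ^ 2 = !![UK p, 0; 0, UK p] := by
    simp [dImg, pow_two]
  have hsq' : dImg p .kinv ^ 2 = !![UKinv p, 0; 0, UKinv p] := by
    simp [dImg, pow_two]
  have w : ∀ ⦃x y : FD⦄, DRel p x y →
      FreeAlgebra.lift ℂ (dImg p) x = FreeAlgebra.lift ℂ (dImg p) y := by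
    intro x y hxy
    cases hxy <;>
    simp only [fe, fphi, fk, fkinv, map_mul, map_one, map_smul, map_sub, map_pow, map_zero,
      FreeAlgebra.lift_ι_apply]
    · have : p ≠ 0 := by omega
      simp only [dImg, diag_pow, smul_pow, hE, smul_zero]
      ext i j; fin_cases i <;> fin_cases j <;> rfl
    · simp only [dImg, diag_pow, smul_pow, hF, smul_zero]
      ext i j; fin_cases i <;> fin_cases j <;> rfl
    · rw [show 4 * p = 2 * (2 * p) by ring, pow_mul, hsq, diag_pow, hK, Matrix.one_fin_two]
    · simp [dImg, h.KKi, Matrix.one_fin_two]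
    · simp [dImg, h.KiK, Matrix.one_fin_two]
    · simp only [dImg, Matrix.mul_fin_two, mul_zero, zero_mul, add_zero, zero_add,
        mul_one, one_mul, smul_zero, mul_smul_comm, smul_mul_assoc, h.KE, smul_smul]
      have e : (qq p)⁻¹ * qq p ^ 2 = qq p := by field_simp
      rw [mul_assoc (UE p), h.KKi, mul_one, e]
      refine Eq.trans ?_ (smul_fin_two' _ _ _ _ _).symm
      simp only [smul_smul, smul_zero, mul_inv_cancel₀ hq, one_smul]
    · simp only [dImg, Matrix.mul_fin_two, mul_zero, zero_mul, add_zero, zero_add,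
        mul_one, one_mul, smul_zero, mul_smul_comm, smul_mul_assoc, h.KF, smul_smul]
      have e : qq p * (qq p ^ 2)⁻¹ = (qq p)⁻¹ := by field_simp
      rw [mul_assoc (UF p), h.KKi, mul_one, e]
      refine Eq.trans ?_ (smul_fin_two' _ _ _ _ _).symm
      simp only [smul_smul, smul_zero, inv_mul_cancel₀ hq, one_smul]
    · rw [hsq, hsq']
      simp only [dImg, Matrix.mul_fin_two, mul_zero, zero_mul, add_zero, zero_add,
        smul_zero, mul_smul_comm, smul_mul_assoc, smul_smul, sub_fin_two', sub_zero,
        mul_inv_cancel₀ hq, inv_mul_cancel₀ hq, one_smul, hEF']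
      refine Eq.trans ?_ (smul_fin_two' _ _ _ _ _).symm
      simp only [smul_zero]
  refine ⟨RingQuot.liftAlgHom ℂ ⟨FreeAlgebra.lift ℂ (dImg p), w⟩, ?_, ?_, ?_, ?_⟩
  · simp [De, fe]
  · simp [Dphi, fphi]
  · simp [Dk, fk]
  · simp [Dkinv, fkinv]

theorem U_induction (p : ℕ) (C : Uq p → Prop) (hs : ∀ c : ℂ, C (algebraMap ℂ _ c))
    (hE : C (UE p)) (hF : C (UF p)) (hK : C (UK p)) (hKi : C (UKinv p))
    (hm : ∀ x y, C x → C y → C (x * y)) (ha : ∀ x y, C x → C y → C (x + y)) (x : Uq p) :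
    C x := by
  obtain ⟨y, rfl⟩ := RingQuot.mkAlgHom_surjective ℂ (URel p) x
  refine FreeAlgebra.induction ℂ UGen (motive := fun y => C (RingQuot.mkAlgHom ℂ (URel p) y))
    ?_ ?_ ?_ ?_ y
  · intro r; simpa using hs r
  · rintro (_ | _ | _ | _)
    · exact hE
    · exact hF
    · exact hK
    · exact hKi
  · intro a b h1 h2; rw [map_mul]; exact hm _ _ h1 h2
  · intro a b h1 h2; rw [map_add]; exact ha _ _ h1 h2

theorem iota_inj (p : ℕ) (hp : 2 ≤ p) (ι : Uq p →ₐ[ℂ] Dq p) (hι : IsIota p ι) :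
    Function.Injective ι := by
  obtain ⟨Φ, h1, h2, h3, h4⟩ := exists_DtoMat p hp
  obtain ⟨i1, i2, i3, i4⟩ := hι
  have key : ∀ x, Φ (ι x) 0 0 = x ∧ Φ (ι x) 1 0 = 0 := by
    intro x
    refine U_induction p (fun x => Φ (ι x) 0 0 = x ∧ Φ (ι x) 1 0 = 0) ?_ ?_ ?_ ?_ ?_ ?_ ?_ x
    · intro c
      simp [Matrix.algebraMap_matrix_apply]
    · simp [i1, h1, dImg]
    · simp [i2, h2, dImg]
    · simp [i3, h3, dImg, pow_two, Matrix.mul_apply]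
    · simp [i4, h4, dImg, pow_two, Matrix.mul_apply]
    · rintro x y ⟨hx, hx'⟩ ⟨hy, hy'⟩
      simp [Matrix.mul_apply, Fin.sum_univ_two, hx, hx', hy, hy']
    · rintro x y ⟨hx, hx'⟩ ⟨hy, hy'⟩
      simp [hx, hx', hy, hy']
  intro x y hxy
  rw [← (key x).1, ← (key y).1, hxy]
end LogHennings
namespace LogHennings

theorem qh_ne_zero (p : ℕ) : qh p ≠ 0 := Complex.exp_ne_zero _

theorem qq_eq (p : ℕ) : qq p = qh p ^ 2 := by
  unfold qq qh
  rw [← Complex.exp_nat_mul]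
  congr 1
  push_cast
  by_cases h : (p : ℂ) = 0
  · simp [h]
  · field_simp

theorem qq_zpow (p : ℕ) (n : ℤ) : qq p ^ n = qh p ^ (2 * n) := by
  rw [qq_eq, zpow_mul]; norm_cast

theorem qh_prim (p : ℕ) (hp : 2 ≤ p) : IsPrimitiveRoot (qh p) (4 * p) := by
  have h := Complex.isPrimitiveRoot_exp (4 * p) (by omega)
  convert h using 1
  unfold qh
  congr 1
  have : (p : ℂ) ≠ 0 := by exact_mod_cast (by omega : p ≠ 0)
  push_cast
  field_simp
  norm_num

theorem qh_pow_p (p : ℕ) (hp : 2 ≤ p) : qh p ^ p = Complex.I := by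
  unfold qh
  rw [← Complex.exp_nat_mul]
  have : (p : ℂ) ≠ 0 := by exact_mod_cast (by omega : p ≠ 0)
  have e : (p : ℂ) * (Real.pi * Complex.I / (2 * p)) = Real.pi / 2 * Complex.I := by
    field_simp
  rw [e, Complex.exp_pi_div_two_mul_I]

theorem qh_4p (p : ℕ) (hp : 2 ≤ p) (n : ℤ) : qh p ^ (4 * (p : ℤ) * n) = 1 := by
  rw [zpow_mul]
  have := (qh_prim p hp).pow_eq_one
  have h2 : qh p ^ (4 * (p : ℤ)) = 1 := by exact_mod_cast this
  rw [h2, one_zpow]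

theorem qh_2p (p : ℕ) (hp : 2 ≤ p) : qh p ^ (2 * (p : ℤ)) = -1 := by
  have h2 : qh p ^ (2 * p) = -1 := by
    rw [mul_comm, pow_mul, qh_pow_p p hp, Complex.I_sq]
  exact_mod_cast h2

theorem qq_prim (p : ℕ) (hp : 2 ≤ p) : IsPrimitiveRoot (qq p) (2 * p) := by
  rw [qq_eq]
  exact (qh_prim p hp).pow (by omega) (by ring)

theorem qq_sq_prim (p : ℕ) (hp : 2 ≤ p) : IsPrimitiveRoot (qq p ^ 2) p :=
  (qq_prim p hp).pow (by omega) (by ring)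

theorem qq_pow_sub_ne (p : ℕ) (m : ℕ) (h0 : 0 < m) (hm : m < p) :
    qq p ^ m - (qq p)⁻¹ ^ m ≠ 0 := by
  intro h
  have h1 : (qq p ^ 2) ^ m = 1 := by
    rw [sub_eq_zero] at h
    calc (qq p ^ 2) ^ m = qq p ^ m * qq p ^ m := by ring
      _ = qq p ^ m * (qq p)⁻¹ ^ m := by rw [← h]
      _ = 1 := by rw [← mul_pow, mul_inv_cancel₀ (qq_ne_zero p), one_pow]
  exact (qq_sq_prim p (by omega)).pow_ne_one_of_pos_of_lt (by omega) hm h1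

theorem qq_sub_ne (p : ℕ) (hp : 2 ≤ p) : qq p - (qq p)⁻¹ ≠ 0 := by
  simpa using qq_pow_sub_ne p 1 (by omega) (by omega)

theorem qnum_ne (p : ℕ) (m : ℕ) (h0 : 0 < m) (hm : m < p) : qnum p m ≠ 0 :=
  div_ne_zero (qq_pow_sub_ne p m h0 hm) (qq_sub_ne p (by omega))

theorem qfac_ne (p : ℕ) (m : ℕ) (hm : m < p) : qfac p m ≠ 0 := by
  induction m with
  | zero => simp [qfac]
  | succ m ih => exact mul_ne_zero (qnum_ne p _ (by omega) hm) (ih (by omega))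

/-- coefficient of `F^m E^m` on the weight `n` part of the ribbon element. -/
def aC (p m : ℕ) (n : ℤ) : ℂ := (qq p - (qq p)⁻¹) ^ m / qfac p m *
  qh p ^ (-(m : ℤ) - (m + n) ^ 2 - 2 * (m + n) * (p + 1))

/-- coefficient of `F^m E^m` on the weight `n` part of the inverse ribbon element. -/
def bC (p m : ℕ) (n : ℤ) : ℂ := (-1) ^ m * ((qq p - (qq p)⁻¹) ^ m / qfac p m) *
  qh p ^ ((m : ℤ) + (m + n) ^ 2 + 2 * (m + n) * (p + 1))

theorem aC_rec (p m : ℕ) (n : ℤ) (hm : m + 1 < p) :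
    aC p m n + aC p (m + 1) n * ((qq p ^ (m + 1) - (qq p)⁻¹ ^ (m + 1)) / (qq p - (qq p)⁻¹) /
      (qq p - (qq p)⁻¹)) * ((qq p)⁻¹ ^ m * qq p ^ (n + 2 * m + 2)
        - qq p ^ m * (qq p ^ (n + 2 * m + 2))⁻¹) = aC p m (n + 2) := by
  have hp : 2 ≤ p := by omega
  have h0 := qh_ne_zero p
  have hd := qq_sub_ne p hp
  have hn : qnum p (m + 1) ≠ 0 := qnum_ne p _ (by omega) hm
  have hf := qfac_ne p m (by omega)
  have e1 : (qq p ^ (m + 1) - (qq p)⁻¹ ^ (m + 1)) / (qq p - (qq p)⁻¹) = qnum p (m + 1) := rfl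
  set X : ℤ := -(m : ℤ) - (m + n) ^ 2 - 2 * (m + n) * (p + 1) with hX
  set Z : ℂ := qh p ^ (2 * (m + n + 2) : ℤ) with hZ
  have hZ0 : Z ≠ 0 := zpow_ne_zero _ h0
  have e2 : qh p ^ (-((m + 1 : ℕ) : ℤ) - (((m + 1 : ℕ) : ℤ) + n) ^ 2
      - 2 * (((m + 1 : ℕ) : ℤ) + n) * (p + 1)) = - (qh p ^ X * Z⁻¹) := by
    have : (-((m + 1 : ℕ) : ℤ) - (((m + 1 : ℕ) : ℤ) + n) ^ 2
      - 2 * (((m + 1 : ℕ) : ℤ) + n) * (p + 1)) = X + -(2 * (m + n + 2)) + -(2 * p) := by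
      rw [hX]; push_cast; ring
    rw [this, zpow_add₀ h0, zpow_add₀ h0, zpow_neg, zpow_neg, qh_2p p hp]
    rw [inv_neg, inv_one]; ring
  have e3 : qh p ^ (-(m : ℤ) - (m + (n + 2)) ^ 2 - 2 * (m + (n + 2)) * (p + 1)) =
      qh p ^ X * Z⁻¹ * Z⁻¹ := by
    have : (-(m : ℤ) - (m + (n + 2)) ^ 2 - 2 * (m + (n + 2)) * (p + 1)) =
      X + -(2 * (m + n + 2)) + -(2 * (m + n + 2)) + 4 * p * (-1) := by
      rw [hX]; ring
    rw [this, zpow_add₀ h0, zpow_add₀ h0, zpow_add₀ h0, qh_4p p hp, zpow_neg, mul_one]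
  have e4 : (qq p)⁻¹ ^ m * qq p ^ (n + 2 * m + 2) = Z := by
    rw [hZ, inv_pow, ← zpow_natCast, ← zpow_neg, ← zpow_add₀ (qq_ne_zero p), qq_zpow]
    congr 1; ring
  have e5 : qq p ^ m * (qq p ^ (n + 2 * m + 2))⁻¹ = Z⁻¹ := by
    rw [← e4, mul_inv, inv_pow, inv_inv]
  rw [e4, e5, e1]
  unfold aC
  rw [e2, e3, ← hX, qfac]
  generalize qq p - (qq p)⁻¹ = d at hd ⊢
  field_simp
  ring

/-- alternating q-binomial sum. -/
theorem qbinom_partial (p N : ℕ) (hN : N + 1 < p) (k : ℕ) (hk : k ≤ N) :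
    ∑ j ∈ range (k + 1), (-1) ^ j * qq p ^ ((j : ℤ) - (N + 1) * j) *
      (qfac p j * qfac p (N + 1 - j))⁻¹ * qnum p (N + 1) =
    (-1) ^ k * qq p ^ (-((N : ℤ) + 1) * k) * (qfac p k * qfac p (N - k))⁻¹ := by
  have h0 := qq_ne_zero p
  induction k with
  | zero =>
    have := qnum_ne p (N + 1) (by omega) hN
    have hf := qfac_ne p N (by omega)
    simp [qfac]
    field_simp
  | succ k ih =>
    rw [sum_range_succ, ih (by omega)]
    obtain ⟨d, rfl⟩ : ∃ d, N = k + 1 + d := ⟨N - (k + 1), by omega⟩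
    have a1 : k + 1 + d + 1 - (k + 1) = d + 1 := by omega
    have a2 : k + 1 + d - k = d + 1 := by omega
    have a3 : k + 1 + d - (k + 1) = d := by omega
    rw [a1, a2, a3, qfac, qfac]
    have n1 := qnum_ne p (k + 1) (by omega) (by omega)
    have n2 := qnum_ne p (d + 1) (by omega) (by omega)
    have n3 := qfac_ne p k (by omega)
    have n4 := qfac_ne p d (by omega)
    have key : qnum p (k + 1 + d + 1) = qq p ^ (d + 1) * qnum p (k + 1)
        + (qq p)⁻¹ ^ (k + 1) * qnum p (d + 1) := by
      unfold qnum
      rw [show k + 1 + d + 1 = (k + 1) + (d + 1) by ring, pow_add, pow_add]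
      ring
    rw [key]
    set M : ℤ := ((k + 1 + d : ℕ) : ℤ) + 1 with hM
    have z1 : qq p ^ (((k + 1 : ℕ) : ℤ) - M * ((k + 1 : ℕ) : ℤ)) * qq p ^ (d + 1) =
        qq p ^ (-M * k) := by
      rw [← zpow_natCast, ← zpow_add₀ h0]; congr 1; rw [hM]; push_cast; ring
    have z2 : qq p ^ (((k + 1 : ℕ) : ℤ) - M * ((k + 1 : ℕ) : ℤ)) * (qq p)⁻¹ ^ (k + 1) =
        qq p ^ (-M * ((k + 1 : ℕ) : ℤ)) := by
      rw [inv_pow, ← zpow_natCast, ← zpow_neg, ← zpow_add₀ h0]; congr 1; ring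
    calc _ = (-1) ^ k * qq p ^ (-M * k) * (qfac p k * (qnum p (d + 1) * qfac p d))⁻¹ +
          (-1) ^ (k + 1) * ((qq p ^ (((k + 1 : ℕ) : ℤ) - M * ((k + 1 : ℕ) : ℤ)) * qq p ^ (d + 1))
            * qnum p (k + 1) +
          (qq p ^ (((k + 1 : ℕ) : ℤ) - M * ((k + 1 : ℕ) : ℤ)) * (qq p)⁻¹ ^ (k + 1))
            * qnum p (d + 1))
          * (qnum p (k + 1) * qfac p k * (qnum p (d + 1) * qfac p d))⁻¹ := by ring
      _ = _ := by
        rw [z1, z2]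
        field_simp
        ring

theorem qbinom_zero (p N : ℕ) (hN : N + 1 < p) :
    ∑ j ∈ range (N + 2), (-1) ^ j * qq p ^ ((j : ℤ) - (N + 1) * j) *
      (qfac p j * qfac p (N + 1 - j))⁻¹ = 0 := by
  have h0 := qq_ne_zero p
  have n1 := qnum_ne p (N + 1) (by omega) hN
  have n2 := qfac_ne p N (by omega)
  apply mul_right_cancel₀ n1
  rw [zero_mul, sum_mul, sum_range_succ, qbinom_partial p N hN N le_rfl]
  have : (((N + 1 : ℕ) : ℤ) - (N + 1) * ((N + 1 : ℕ) : ℤ)) = -((N : ℤ) + 1) * N := by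
    push_cast; ring
  rw [this]
  simp only [Nat.sub_self, qfac]
  field_simp
  ring

theorem ab_sum (p M : ℕ) (hM : M < p) (n : ℤ) :
    ∑ k ∈ range (M + 1), bC p k n * aC p (M - k) (n + 2 * k) = if M = 0 then 1 else 0 := by
  have h0 := qh_ne_zero p
  rcases M with _ | N
  · simp [aC, bC, qfac]
    rw [← zpow_add₀ h0]
    convert zpow_zero _ using 2
    ring
  · rw [if_neg (by omega)]
    have hz := qbinom_zero p N hM
    have : ∀ k ∈ range (N + 1 + 1), bC p k n * aC p (N + 1 - k) (n + 2 * k) =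
      ((qq p - (qq p)⁻¹) ^ (N + 1) *
        qh p ^ (-((N : ℤ) + 1) - (N + 1) * (N + 1 + 2 * n) - 2 * (N + 1) * (p + 1))) *
      ((-1) ^ k * qq p ^ ((k : ℤ) - (N + 1) * k) * (qfac p k * qfac p (N + 1 - k))⁻¹) := by
      intro k hk
      obtain ⟨m, hm⟩ : ∃ m, N + 1 = k + m := ⟨N + 1 - k, by have := mem_range.1 hk; omega⟩
      have hNm : (N : ℤ) = k + m - 1 := by omega
      rw [hNm, hm, Nat.add_sub_cancel_left]
      unfold aC bC
      rw [qq_zpow]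
      have hh : qh p ^ ((k : ℤ) + (k + n) ^ 2 + 2 * (k + n) * (p + 1)) *
        qh p ^ (-(m : ℤ) - (m + (n + 2 * k)) ^ 2 - 2 * (m + (n + 2 * k)) * (p + 1)) =
        qh p ^ (-((k : ℤ) + m - 1 + 1) - (k + m - 1 + 1) * (k + m - 1 + 1 + 2 * n)
          - 2 * (k + m - 1 + 1) * (p + 1)) *
        qh p ^ (2 * ((k : ℤ) - (k + m - 1 + 1) * k)) := by
        rw [← zpow_add₀ h0, ← zpow_add₀ h0]; congr 1; ring
      calc _ = (-1) ^ k * ((qq p - (qq p)⁻¹) ^ k * (qq p - (qq p)⁻¹) ^ m)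
            * (qfac p k * qfac p m)⁻¹ *
            (qh p ^ ((k : ℤ) + (k + n) ^ 2 + 2 * (k + n) * (p + 1)) *
        qh p ^ (-(m : ℤ) - (m + (n + 2 * k)) ^ 2 - 2 * (m + (n + 2 * k)) * (p + 1))) := by
            rw [mul_inv]; ring
        _ = _ := by rw [hh, pow_add]; ring
    rw [sum_congr rfl this, ← mul_sum, hz, mul_zero]

/-- Gauss sum. -/
def gaussG (p : ℕ) : ℂ := ∑ j ∈ range (2 * p), qh p ^ ((j : ℤ) ^ 2)

theorem gauss_shift (p : ℕ) (hp : 2 ≤ p) (N : ℤ) :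
    ∑ j ∈ range (2 * p), qh p ^ (((j : ℤ) + N) ^ 2) = gaussG p := by
  have h0 := qh_ne_zero p
  have step : ∀ N : ℤ, ∑ j ∈ range (2 * p), qh p ^ (((j : ℤ) + (N + 1)) ^ 2) =
      ∑ j ∈ range (2 * p), qh p ^ (((j : ℤ) + N) ^ 2) := by
    intro N
    have h1 := sum_range_succ (fun j : ℕ => qh p ^ (((j : ℤ) + N) ^ 2)) (2 * p)
    rw [sum_range_succ'] at h1
    have h2 : qh p ^ ((((2 * p : ℕ) : ℤ) + N) ^ 2) = qh p ^ ((((0 : ℕ) : ℤ) + N) ^ 2) := by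
      have : (((2 * p : ℕ) : ℤ) + N) ^ 2 = (((0 : ℕ) : ℤ) + N) ^ 2 + 4 * p * (N + p) := by
        push_cast; ring
      rw [this, zpow_add₀ h0, qh_4p p hp, mul_one]
    rw [h2] at h1
    have h3 := add_right_cancel h1
    rw [← h3]
    refine sum_congr rfl fun j _ => ?_
    congr 2; push_cast; ring
  induction N using Int.induction_on with
  | zero => simp [gaussG]
  | succ n ih => rw [step]; exact ih
  | pred n ih =>
    rw [← ih, ← step]
    refine sum_congr rfl fun j _ => ?_
    congr 2; ring

theorem prod_sub (p : ℕ) (hp : 2 ≤ p) :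
    (qq p - (qq p)⁻¹) ^ (p - 1) * qfac p (p - 1) = Complex.I ^ (p - 1) * p := by
  have hd := qq_sub_ne p hp
  have h1 : ∀ m, (qq p - (qq p)⁻¹) ^ m * qfac p m =
      ∏ k ∈ range m, (qq p ^ (k + 1) - (qq p)⁻¹ ^ (k + 1)) := by
    intro m
    induction m with
    | zero => simp [qfac]
    | succ m ih =>
      rw [prod_range_succ, ← ih, qfac, qnum]
      clear ih
      generalize qq p ^ (m + 1) - (qq p)⁻¹ ^ (m + 1) = w
      generalize qq p - (qq p)⁻¹ = d at hd ⊢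
      field_simp
      ring
  have h2 : ∀ m, qh p ^ (m * (m + 1)) * ∏ k ∈ range m, (qq p ^ (k + 1) - (qq p)⁻¹ ^ (k + 1)) =
      (-1) ^ m * ∏ k ∈ range m, (1 - (qq p ^ 2) ^ (k + 1)) := by
    intro m
    induction m with
    | zero => simp
    | succ m ih =>
      rw [prod_range_succ, prod_range_succ]
      have e : qh p ^ ((m + 1) * (m + 1 + 1)) = qh p ^ (m * (m + 1)) * qq p ^ (m + 1) := by
        rw [qq_eq]; ring
      have e2 : qq p ^ (m + 1) * (qq p ^ (m + 1) - (qq p)⁻¹ ^ (m + 1)) =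
          -(1 - (qq p ^ 2) ^ (m + 1)) := by
        have e3 : qq p ^ (m + 1) * (qq p)⁻¹ ^ (m + 1) = 1 := by
          rw [← mul_pow, mul_inv_cancel₀ (qq_ne_zero p), one_pow]
        rw [mul_sub, e3]; ring
      calc _ = (qh p ^ (m * (m + 1)) * ∏ k ∈ range m, (qq p ^ (k + 1) - (qq p)⁻¹ ^ (k + 1))) *
            (qq p ^ (m + 1) * (qq p ^ (m + 1) - (qq p)⁻¹ ^ (m + 1))) := by rw [e]; ring
        _ = _ := by rw [ih, e2]; ring
  obtain ⟨m, rfl⟩ : ∃ m, p = m + 1 := ⟨p - 1, by omega⟩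
  have h3 := IsPrimitiveRoot.prod_one_sub_pow_eq_order (qq_sq_prim (m + 1) hp)
  rw [Nat.add_sub_cancel, h1]
  have h4 := h2 m
  rw [h3, mul_comm m, pow_mul, qh_pow_p _ hp] at h4
  have hI : Complex.I ^ m * Complex.I ^ m = (-1) ^ m := by
    rw [← mul_pow, Complex.I_mul_I]
  apply mul_left_cancel₀ (pow_ne_zero m Complex.I_ne_zero)
  rw [h4, ← mul_assoc, hI]
  push_cast; ring
end LogHennings
namespace LogHennings
section
variable {A : Type*} [Ring A] [Algebra ℂ A] {p : ℕ} {E F K Ki : A}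

/-- unnormalized weight projector. -/
def eK (p : ℕ) (K : A) (n : ℤ) : A := ∑ j ∈ range (2 * p), qq p ^ (-n * (j : ℤ)) • K ^ j

theorem K_eK (hp : 2 ≤ p) (hK : K ^ (2 * p) = 1) (n : ℤ) :
    K * eK p K n = qq p ^ n • eK p K n := by
  have h0 := qq_ne_zero p
  have h1 := sum_range_succ (fun j : ℕ => qq p ^ (-n * (j : ℤ)) • K ^ j) (2 * p)
  rw [sum_range_succ'] at h1
  have h2 : qq p ^ (-n * ((2 * p : ℕ) : ℤ)) • K ^ (2 * p)
      = qq p ^ (-n * ((0 : ℕ) : ℤ)) • K ^ 0 := by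
    rw [hK, qq_zpow, show 2 * (-n * ((2 * p : ℕ) : ℤ)) = 4 * p * (-n) by push_cast; ring,
      qh_4p p hp]
    simp
  rw [h2] at h1
  have h3 := add_right_cancel h1
  unfold eK
  conv_rhs => rw [← h3]
  rw [mul_sum, smul_sum]
  refine sum_congr rfl fun j _ => ?_
  rw [mul_smul_comm, smul_smul, ← pow_succ', ← zpow_add₀ h0]
  congr 2
  push_cast; ring

theorem Kpow_eK (hp : 2 ≤ p) (hK : K ^ (2 * p) = 1) (n : ℤ) (j : ℕ) :
    K ^ j * eK p K n = qq p ^ (n * j) • eK p K n := by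
  induction j with
  | zero => simp
  | succ j ih =>
    rw [pow_succ', mul_assoc, ih, mul_smul_comm, K_eK hp hK, smul_smul,
      ← zpow_add₀ (qq_ne_zero p)]
    congr 2
    push_cast; ring

theorem E_Kpow (h : QRel (qq p) E F K Ki) (j : ℕ) :
    E * K ^ j = qq p ^ (-2 * (j : ℤ)) • (K ^ j * E) := by
  have h0 := qq_ne_zero p
  have h1 : E * K = qq p ^ (-2 : ℤ) • (K * E) := by
    rw [h.KE, smul_smul, zpow_neg]
    rw [show (qq p ^ (2 : ℤ)) = qq p ^ 2 by norm_cast, inv_mul_cancel₀ (pow_ne_zero _ h0),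
      one_smul]
  induction j with
  | zero => simp
  | succ j ih =>
    rw [pow_succ, ← mul_assoc, ih, smul_mul_assoc, mul_assoc, h1, mul_smul_comm, smul_smul,
      ← zpow_add₀ h0, mul_assoc]
    congr 2
    push_cast; ring

theorem E_eK (h : QRel (qq p) E F K Ki) (n : ℤ) : E * eK p K n = eK p K (n + 2) * E := by
  unfold eK
  rw [mul_sum, sum_mul]
  refine sum_congr rfl fun j _ => ?_
  rw [mul_smul_comm, E_Kpow h, smul_smul, smul_mul_assoc, ← zpow_add₀ (qq_ne_zero p)]
  congr 2
  ring

theorem Epow_eK (h : QRel (qq p) E F K Ki) (n : ℤ) (k : ℕ) :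
    E ^ k * eK p K n = eK p K (n + 2 * k) * E ^ k := by
  induction k with
  | zero => simp
  | succ k ih =>
    rw [pow_succ', mul_assoc, ih, ← mul_assoc, E_eK h, mul_assoc]
    congr 2
    push_cast; ring

theorem sum_eK (hp : 2 ≤ p) (K : A) :
    ∑ n ∈ range (2 * p), eK p K (n : ℤ) = (2 * (p : ℂ)) • (1 : A) := by
  unfold eK
  rw [sum_comm]
  have h0 := qq_ne_zero p
  have : ∀ j ∈ range (2 * p), ∑ n ∈ range (2 * p), qq p ^ (-(n : ℤ) * (j : ℤ)) • K ^ j =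
      if j = 0 then (2 * (p : ℂ)) • (1 : A) else 0 := by
    intro j hj
    rw [← sum_smul]
    split_ifs with hj0
    · subst hj0; simp
    · have hprim := (qq_prim p hp).inv
      have hne : (qq p)⁻¹ ^ j ≠ 1 :=
        hprim.pow_ne_one_of_pos_of_lt hj0 (mem_range.1 hj)
      have e : ∀ n ∈ range (2 * p), qq p ^ (-(n : ℤ) * (j : ℤ)) = ((qq p)⁻¹ ^ j) ^ n := by
        intro n _
        rw [← pow_mul, inv_pow, ← zpow_natCast, ← zpow_neg]
        congr 1
        push_cast; ring
      rw [sum_congr rfl e, geom_sum_eq hne, ← pow_mul, mul_comm j, pow_mul, hprim.pow_eq_one]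
      simp
  rw [sum_congr rfl this, sum_ite_eq' (range (2 * p)) 0, if_pos (mem_range.2 (by omega))]

/-- weight component of the ribbon element. -/
def TT (p : ℕ) (E F K : A) (n : ℤ) : A :=
  ∑ m ∈ range p, aC p m n • (F ^ m * E ^ m * eK p K n)

theorem K_Em (h : QRel (qq p) E F K Ki) (hp : 2 ≤ p) (hK : K ^ (2 * p) = 1) (n : ℤ) (m : ℕ) :
    K * (E ^ (m + 1) * eK p K n) = qq p ^ (n + 2 * m + 2) • (E ^ (m + 1) * eK p K n) := by
  rw [← mul_assoc, h.Kpow_comm, smul_mul_assoc, mul_assoc, K_eK hp hK, mul_smul_comm, smul_smul]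
  congr 1
  rw [← pow_mul, ← zpow_natCast, ← zpow_add₀ (qq_ne_zero p)]
  congr 1
  push_cast; ring

theorem Ki_Em (h : QRel (qq p) E F K Ki) (hp : 2 ≤ p) (hK : K ^ (2 * p) = 1) (n : ℤ) (m : ℕ) :
    Ki * (E ^ (m + 1) * eK p K n) = (qq p ^ (n + 2 * m + 2))⁻¹ • (E ^ (m + 1) * eK p K n) := by
  have h1 := K_Em h hp hK n m
  have h2 : E ^ (m + 1) * eK p K n =
      qq p ^ (n + 2 * m + 2) • (Ki * (E ^ (m + 1) * eK p K n)) := by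
    rw [← mul_smul_comm, ← h1, ← mul_assoc Ki, h.KiK, one_mul]
  conv_rhs => rw [h2]
  rw [smul_smul, inv_mul_cancel₀ (zpow_ne_zero _ (qq_ne_zero p)), one_smul]

theorem E_TT (h : QRel (qq p) E F K Ki) (hp : 2 ≤ p) (hK : K ^ (2 * p) = 1) (hE : E ^ p = 0)
    (n : ℤ) : E * TT p E F K n = TT p E F K (n + 2) * E := by
  unfold TT
  rw [mul_sum, sum_mul]
  have hR : ∀ m ∈ range p, aC p m (n + 2) • (F ^ m * E ^ m * eK p K (n + 2)) * E =
      aC p m (n + 2) • (F ^ m * E ^ (m + 1) * eK p K n) := by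
    intro m _
    rw [smul_mul_assoc, mul_assoc _ (eK p K (n + 2)), ← E_eK h, pow_succ]
    simp only [mul_assoc]
  rw [sum_congr rfl hR]
  obtain ⟨P, rfl⟩ : ∃ P, p = P + 1 := ⟨p - 1, by omega⟩
  set q := qq (P + 1) with hqdef
  set X : ℕ → A := fun m => F ^ m * E ^ (m + 1) * eK (P + 1) K n with hXd
  have hXP : X P = 0 := by simp only [hXd, hE, mul_zero, zero_mul]
  set w : ℕ → ℂ := fun m => ((q ^ (m + 1) - q⁻¹ ^ (m + 1)) / (q - q⁻¹) / (q - q⁻¹)) *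
    (q⁻¹ ^ m * q ^ (n + 2 * m + 2) - q ^ m * (q ^ (n + 2 * m + 2))⁻¹) with hw
  have hL : ∀ m, E * aC (P + 1) (m + 1) n • (F ^ (m + 1) * E ^ (m + 1) * eK (P + 1) K n) =
      aC (P + 1) (m + 1) n • X (m + 1) + (aC (P + 1) (m + 1) n * w m) • X m := by
    intro m
    rw [mul_smul_comm, mul_smul, ← smul_add]
    congr 1
    rw [mul_assoc (F ^ (m + 1)), ← mul_assoc E, h.EFpow (qq_ne_zero _) (qq_sub_ne _ hp), add_mul]
    congr 1
    · simp only [hXd, pow_succ' E (m + 1), mul_assoc]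
    · rw [smul_mul_assoc, mul_assoc (F ^ m), sub_mul, smul_mul_assoc, smul_mul_assoc,
        K_Em h hp hK, Ki_Em h hp hK, smul_smul, smul_smul, ← sub_smul, mul_smul_comm, smul_smul,
        hw, hXd]
      simp only [mul_assoc]
      rfl
  rw [sum_range_succ', sum_congr rfl (fun m _ => hL m), sum_add_distrib]
  have hz : E * aC (P + 1) 0 n • (F ^ 0 * E ^ 0 * eK (P + 1) K n) = aC (P + 1) 0 n • X 0 := by
    simp [hXd]
  rw [hz]
  have h1 : ∑ m ∈ range P, aC (P + 1) (m + 1) n • X (m + 1) + aC (P + 1) 0 n • X 0 =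
      ∑ m ∈ range P, aC (P + 1) m n • X m := by
    rw [← sum_range_succ' (fun m => aC (P + 1) m n • X m), sum_range_succ, hXP, smul_zero,
      add_zero]
  rw [add_right_comm, h1, ← sum_add_distrib, sum_range_succ]
  change _ = _ + aC (P + 1) P (n + 2) • X P
  rw [hXP, smul_zero, add_zero]
  refine sum_congr rfl fun m hm => ?_
  rw [← add_smul]
  change _ = aC (P + 1) m (n + 2) • X m
  rw [← aC_rec (P + 1) m n (by have := mem_range.1 hm; omega), hw, mul_assoc]

theorem Epow_TT (h : QRel (qq p) E F K Ki) (hp : 2 ≤ p) (hK : K ^ (2 * p) = 1) (hE : E ^ p = 0)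
    (n : ℤ) (k : ℕ) : E ^ k * TT p E F K n = TT p E F K (n + 2 * k) * E ^ k := by
  induction k with
  | zero => simp
  | succ k ih =>
    rw [pow_succ', mul_assoc, ih, ← mul_assoc, E_TT h hp hK hE, mul_assoc]
    congr 2
    push_cast; ring

/-- coefficients of the ribbon element. -/
def rc (p m j : ℕ) : ℂ := ((qq p - (qq p)⁻¹) ^ m / qfac p m) *
  (qh p) ^ (-(m : ℤ) + 2 * (m : ℤ) * (j : ℤ) + ((j : ℤ) + (p : ℤ) + 1) ^ 2)

/-- ribbon element inside the abstract algebra. -/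
def ribA (p : ℕ) (c : ℂ) (E F K : A) : A :=
  c • ∑ m ∈ range p, ∑ j ∈ range (2 * p), rc p m j • (F ^ m * E ^ m * K ^ j)

theorem rc_sum (hp : 2 ≤ p) (m : ℕ) (n : ℤ) :
    ∑ j ∈ range (2 * p), rc p m j * qq p ^ (n * j) = gaussG p * aC p m n := by
  have h0 := qh_ne_zero p
  rw [← gauss_shift p hp (p + 1 + m + n), sum_mul]
  refine sum_congr rfl fun j _ => ?_
  unfold rc aC
  have hh : qh p ^ (-(m : ℤ) + 2 * (m : ℤ) * (j : ℤ) + ((j : ℤ) + (p : ℤ) + 1) ^ 2) *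
      qh p ^ (2 * (n * j)) = qh p ^ (((j : ℤ) + (p + 1 + m + n)) ^ 2) *
      qh p ^ (-(m : ℤ) - (m + n) ^ 2 - 2 * (m + n) * (p + 1)) := by
    rw [← zpow_add₀ h0, ← zpow_add₀ h0]; congr 1; ring
  rw [qq_zpow]
  linear_combination ((qq p - (qq p)⁻¹) ^ m / qfac p m) * hh

theorem ribA_eK (hp : 2 ≤ p) (hK : K ^ (2 * p) = 1) (c : ℂ) (n : ℤ) :
    ribA p c E F K * eK p K n = (c * gaussG p) • TT p E F K n := by
  unfold ribA TT
  rw [smul_mul_assoc, mul_smul]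
  congr 1
  rw [sum_mul, smul_sum]
  refine sum_congr rfl fun m _ => ?_
  rw [smul_smul, ← rc_sum hp, sum_smul, sum_mul]
  refine sum_congr rfl fun j _ => ?_
  rw [smul_mul_assoc, mul_assoc, Kpow_eK hp hK, mul_smul_comm, smul_smul]

theorem K_FE (h : QRel (qq p) E F K Ki) (m : ℕ) : Commute K (F ^ m * E ^ m) := by
  have h0 := qq_ne_zero p
  induction m with
  | zero => simp
  | succ m ih =>
    have : F ^ (m + 1) * E ^ (m + 1) = F * (F ^ m * E ^ m) * E := by
      rw [pow_succ' F, pow_succ E]; noncomm_ring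
    rw [this]
    unfold Commute SemiconjBy
    rw [← mul_assoc, ← mul_assoc, h.KF, smul_mul_assoc, smul_mul_assoc, mul_assoc F K, ih.eq,
      mul_assoc F, mul_assoc _ K E, h.KE, mul_smul_comm, mul_smul_comm, smul_smul,
      inv_mul_cancel₀ (pow_ne_zero _ h0), one_smul]
    simp only [mul_assoc]

theorem ribA_comm (h : QRel (qq p) E F K Ki) (c : ℂ) (n : ℤ) :
    eK p K n * ribA p c E F K = ribA p c E F K * eK p K n := by
  have h1 : Commute K (ribA p c E F K) := by
    unfold ribA
    refine Commute.smul_right (Commute.sum_right _ _ _ fun m _ => Commute.sum_right _ _ _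
      fun j _ => Commute.smul_right ((K_FE h m).mul_right ?_) _) _
    exact (Commute.refl K).pow_right j
  unfold eK
  exact (Commute.sum_left _ _ _ fun j _ => Commute.smul_left (h1.pow_left j) _).eq

/-- the (rescaled) inverse of the ribbon element. -/
def ribInv (p : ℕ) (E F K : A) : A :=
  ∑ n ∈ range (2 * p), ∑ k ∈ range p, bC p k n • (F ^ k * E ^ k * eK p K (n : ℤ))

theorem ribInv_mul (h : QRel (qq p) E F K Ki) (hp : 2 ≤ p) (hK : K ^ (2 * p) = 1)
    (hE : E ^ p = 0) (c : ℂ) :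
    ribInv p E F K * ribA p c E F K = (c * gaussG p * (2 * p)) • 1 := by
  have key : ∀ n : ℤ, ∑ k ∈ range p, bC p k n • (F ^ k * (TT p E F K (n + 2 * k) * E ^ k))
      = eK p K n := by
    intro n
    set f : ℕ → ℕ → A := fun k m => (bC p k n * aC p m (n + 2 * k)) •
      (F ^ (k + m) * E ^ (k + m) * eK p K n) with hf
    have h1 : ∀ k ∈ range p, bC p k n • (F ^ k * (TT p E F K (n + 2 * k) * E ^ k)) =
        ∑ m ∈ range (p - k), f k m := by
      intro k hk
      have h2 : bC p k n • (F ^ k * (TT p E F K (n + 2 * k) * E ^ k)) =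
          ∑ m ∈ range p, f k m := by
        unfold TT
        rw [sum_mul, mul_sum, smul_sum]
        refine sum_congr rfl fun m _ => ?_
        rw [smul_mul_assoc, mul_assoc _ (eK p K _), ← Epow_eK h, mul_smul_comm, smul_smul, hf]
        simp only [pow_add F, add_comm k m, pow_add E, mul_assoc]
        simp only [← mul_assoc (F ^ k), ← mul_assoc (F ^ m), ← pow_add, add_comm k m]
      rw [h2]
      symm
      apply sum_subset
      · intro x hx; rw [mem_range] at hx ⊢; omega
      · intro m _ hm
        rw [mem_range, not_lt] at hm
        have hk' := mem_range.1 hk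
        simp only [hf]
        rw [show k + m = p + (k + m - p) by omega, pow_add E, hE]
        simp
    rw [sum_congr rfl h1, ← sum_range_diag_flip]
    have h3 : ∀ M ∈ range p, ∑ k ∈ range (M + 1), f k (M - k) =
        if M = 0 then eK p K n else 0 := by
      intro M hM
      have h4 : ∀ k ∈ range (M + 1), f k (M - k) = (bC p k n * aC p (M - k) (n + 2 * k)) •
          (F ^ M * E ^ M * eK p K n) := by
        intro k hk
        have := mem_range.1 hk
        simp only [hf]
        rw [show k + (M - k) = M by omega]
      rw [sum_congr rfl h4, ← sum_smul, ab_sum p M (mem_range.1 hM)]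
      split_ifs with h0
      · subst h0; simp
      · simp
    rw [sum_congr rfl h3, sum_ite_eq' (range p) 0, if_pos (mem_range.2 (by omega))]
  unfold ribInv
  rw [sum_mul]
  have h5 : ∀ n ∈ range (2 * p), (∑ k ∈ range p, bC p k n • (F ^ k * E ^ k * eK p K (n : ℤ))) *
      ribA p c E F K = (c * gaussG p) • eK p K (n : ℤ) := by
    intro n _
    conv_rhs => rw [← key n]
    rw [sum_mul, smul_sum]
    refine sum_congr rfl fun k _ => ?_
    rw [smul_mul_assoc, mul_assoc _ (eK p K _), ribA_comm h, ribA_eK hp hK, mul_smul_comm,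
      mul_assoc, Epow_TT h hp hK hE, smul_comm]
  rw [sum_congr rfl h5, ← smul_sum, sum_eK hp, smul_smul]

theorem mu_ribA (hp : 2 ≤ p) (μ : A →ₗ[ℂ] ℂ) (z c : ℂ)
    (hμ : ∀ m j : ℕ, m < p → j < 2 * p → μ (F ^ m * E ^ m * K ^ j) =
      if m = p - 1 ∧ j = p + 1 then z else 0) :
    μ (ribA p c E F K) = c * (rc p (p - 1) (p + 1) * z) := by
  unfold ribA
  rw [map_smul, smul_eq_mul, map_sum]
  congr 1
  rw [sum_eq_single_of_mem (p - 1) (mem_range.2 (by omega)), map_sum,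
    sum_eq_single_of_mem (p + 1) (mem_range.2 (by omega)), map_smul, hμ _ _ (by omega) (by omega)]
  · simp
  · intro j hj hne
    rw [map_smul, hμ _ _ (by omega) (mem_range.1 hj), if_neg (by omega), smul_zero]
  · intro m hm hne
    rw [map_sum]
    refine sum_eq_zero fun j hj => ?_
    rw [map_smul, hμ _ _ (mem_range.1 hm) (mem_range.1 hj), if_neg (by omega), smul_zero]

theorem mu_ribInv (hp : 2 ≤ p) (μ : A →ₗ[ℂ] ℂ) (z : ℂ)
    (hμ : ∀ m j : ℕ, m < p → j < 2 * p → μ (F ^ m * E ^ m * K ^ j) =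
      if m = p - 1 ∧ j = p + 1 then z else 0) :
    μ (ribInv p E F K) = z * ((-1) ^ (p - 1) * ((qq p - (qq p)⁻¹) ^ (p - 1) / qfac p (p - 1)) *
      qh p ^ (2 * (p : ℤ) ^ 2 + p - 3)) * gaussG p := by
  have h0 := qh_ne_zero p
  have h1 : ∀ k < p, ∀ n : ℤ, μ (F ^ k * E ^ k * eK p K n) =
      if k = p - 1 then qq p ^ (-n * (p + 1)) * z else 0 := by
    intro k hk n
    unfold eK
    rw [mul_sum, map_sum]
    rw [sum_eq_single_of_mem (p + 1) (mem_range.2 (by omega)), mul_smul_comm, map_smul,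
      hμ _ _ hk (by omega)]
    · by_cases hk1 : k = p - 1
      · simp [hk1]
      · simp [hk1]
    · intro j hj hne
      rw [mul_smul_comm, map_smul, hμ _ _ hk (mem_range.1 hj), if_neg (by omega), smul_zero]
  unfold ribInv
  rw [map_sum, ← gauss_shift p hp ((p : ℤ) - 1), mul_sum]
  refine sum_congr rfl fun n _ => ?_
  rw [map_sum, sum_eq_single_of_mem (p - 1) (mem_range.2 (by omega)), map_smul,
    h1 _ (by omega), if_pos rfl, smul_eq_mul]
  · unfold bC
    have hc : ((p - 1 : ℕ) : ℤ) = p - 1 := by omega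
    rw [hc, qq_zpow]
    have e : qh p ^ ((p : ℤ) - 1 + (p - 1 + n) ^ 2 + 2 * (p - 1 + n) * (p + 1)) *
        qh p ^ (2 * (-(n : ℤ) * (p + 1))) =
        qh p ^ (2 * (p : ℤ) ^ 2 + p - 3) * qh p ^ (((n : ℤ) + (p - 1)) ^ 2) := by
      rw [← zpow_add₀ h0, ← zpow_add₀ h0]; congr 1; ring
    linear_combination (z * ((-1) ^ (p - 1) *
      ((qq p - (qq p)⁻¹) ^ (p - 1) / qfac p (p - 1)))) * e
  · intro k hk hne
    rw [map_smul, h1 _ (mem_range.1 hk), if_neg hne, smul_zero]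
end
end LogHennings
namespace LogHennings

theorem sqrt_facts (p : ℕ) (hp : 2 ≤ p) : (Real.sqrt (2 / (p : ℝ)) : ℂ) =
    (Real.sqrt 2 : ℂ) / (Real.sqrt p : ℂ) ∧ (Real.sqrt 2 : ℂ) ^ 2 = 2 ∧
    (Real.sqrt p : ℂ) ^ 2 = p ∧ (Real.sqrt 2 : ℂ) ≠ 0 ∧ (Real.sqrt p : ℂ) ≠ 0 := by
  have hp0 : (0 : ℝ) < p := by exact_mod_cast (by omega : 0 < p)
  refine ⟨?_, ?_, ?_, ?_, ?_⟩
  · rw [Real.sqrt_div (by norm_num)]; push_cast; rfl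
  · rw [← Complex.ofReal_pow, Real.sq_sqrt (by norm_num)]; norm_num
  · rw [← Complex.ofReal_pow, Real.sq_sqrt hp0.le]; norm_num
  · exact_mod_cast (Real.sqrt_pos.2 (by norm_num)).ne'
  · exact_mod_cast (Real.sqrt_pos.2 hp0).ne'

theorem I_pow_eq (p : ℕ) (hp : 2 ≤ p) :
    Complex.I ^ (p - 1) = qh p ^ ((p : ℤ) * (p - 1)) := by
  have hc : ((p - 1 : ℕ) : ℤ) = p - 1 := by omega
  rw [zpow_mul, zpow_natCast, qh_pow_p p hp, ← hc, zpow_natCast]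

theorem val1 (p : ℕ) (hp : 2 ≤ p) :
    ((1 - Complex.I) / (2 * (Real.sqrt p : ℂ))) * (rc p (p - 1) (p + 1) *
      (-((Real.sqrt (2 / (p : ℝ)) : ℂ)) * (qfac p (p - 1)) ^ 2)) =
    ((1 - Complex.I) / (Real.sqrt 2 : ℂ)) * qh p ^ (3 - (p : ℤ) ^ 2) := by
  obtain ⟨h1, h2, h3, h4, h5⟩ := sqrt_facts p hp
  have hf := qfac_ne p (p - 1) (by omega)
  have hP := prod_sub p hp
  have h0 := qh_ne_zero p
  have hc : ((p - 1 : ℕ) : ℤ) = p - 1 := by omega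
  have hI : -(Complex.I ^ (p - 1)) * qh p ^ (6 * (p : ℤ) ^ 2 + 7 * p + 3) =
      qh p ^ (3 - (p : ℤ) ^ 2) := by
    have e : qh p ^ (2 * (p : ℤ)) * qh p ^ ((p : ℤ) * (p - 1)) *
        qh p ^ (6 * (p : ℤ) ^ 2 + 7 * p + 3) =
        qh p ^ (3 - (p : ℤ) ^ 2) * qh p ^ (4 * (p : ℤ) * (2 * p + 2)) := by
      rw [← zpow_add₀ h0, ← zpow_add₀ h0, ← zpow_add₀ h0]; congr 1; ring
    rw [qh_2p p hp, qh_4p p hp, ← I_pow_eq p hp] at e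
    linear_combination e
  unfold rc
  rw [hc, show -((p : ℤ) - 1) + 2 * (p - 1) * ((p + 1 : ℕ) : ℤ) +
    (((p + 1 : ℕ) : ℤ) + p + 1) ^ 2 = 6 * (p : ℤ) ^ 2 + 7 * p + 3 by push_cast; ring, ← hI, h1]
  generalize qh p ^ (6 * (p : ℤ) ^ 2 + 7 * p + 3) = X at *
  generalize (Real.sqrt 2 : ℂ) = t at *
  generalize (Real.sqrt p : ℂ) = s at *
  generalize (qq p - (qq p)⁻¹) ^ (p - 1) = Y at *
  generalize qfac p (p - 1) = f at *
  generalize Complex.I ^ (p - 1) = J at *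
  rw [← h3] at hP
  have e1 : (1 - Complex.I) / (2 * s) * (Y / f * X * (-(t / s) * f ^ 2)) =
      -(1 - Complex.I) * X * t * (Y * f) / (2 * s ^ 2) := by
    field_simp
  rw [e1, hP, ← h2]
  field_simp

theorem val2 (p : ℕ) (hp : 2 ≤ p) :
    (((1 - Complex.I) / (2 * (Real.sqrt p : ℂ))) * (rc p (p - 1) (p + 1) *
      (-((Real.sqrt (2 / (p : ℝ)) : ℂ)) * (qfac p (p - 1)) ^ 2))) *
    ((-((Real.sqrt (2 / (p : ℝ)) : ℂ)) * (qfac p (p - 1)) ^ 2) *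
      ((-1) ^ (p - 1) * ((qq p - (qq p)⁻¹) ^ (p - 1) / qfac p (p - 1)) *
      qh p ^ (2 * (p : ℤ) ^ 2 + p - 3))) =
    ((1 - Complex.I) / (2 * (Real.sqrt p : ℂ))) * (2 * p) := by
  obtain ⟨h1, h2, h3, h4, h5⟩ := sqrt_facts p hp
  have hf := qfac_ne p (p - 1) (by omega)
  have hP := prod_sub p hp
  have h0 := qh_ne_zero p
  have hJ : (-1 : ℂ) ^ (p - 1) * (Complex.I ^ (p - 1)) ^ 2 = 1 := by
    rw [← pow_mul, mul_comm (p - 1) 2, pow_mul, Complex.I_sq, ← mul_pow]; norm_num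
  rw [val1 p hp]
  have hI : -(Complex.I ^ (p - 1)) * qh p ^ (6 * (p : ℤ) ^ 2 + 7 * p + 3) =
      qh p ^ (3 - (p : ℤ) ^ 2) := by
    have e : qh p ^ (2 * (p : ℤ)) * qh p ^ ((p : ℤ) * (p - 1)) *
        qh p ^ (6 * (p : ℤ) ^ 2 + 7 * p + 3) =
        qh p ^ (3 - (p : ℤ) ^ 2) * qh p ^ (4 * (p : ℤ) * (2 * p + 2)) := by
      rw [← zpow_add₀ h0, ← zpow_add₀ h0, ← zpow_add₀ h0]; congr 1; ring
    rw [qh_2p p hp, qh_4p p hp, ← I_pow_eq p hp] at e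
    linear_combination e
  have hX : qh p ^ (6 * (p : ℤ) ^ 2 + 7 * p + 3) * qh p ^ (2 * (p : ℤ) ^ 2 + p - 3) = 1 := by
    rw [← zpow_add₀ h0, ← qh_4p p hp (2 * p + 2)]; congr 1; ring
  rw [← hI, h1]
  generalize qh p ^ (6 * (p : ℤ) ^ 2 + 7 * p + 3) = X at *
  generalize qh p ^ (2 * (p : ℤ) ^ 2 + p - 3) = Z at *
  generalize (Real.sqrt 2 : ℂ) = t at *
  generalize (Real.sqrt p : ℂ) = s at *
  generalize (qq p - (qq p)⁻¹) ^ (p - 1) = Y at *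
  generalize qfac p (p - 1) = f at *
  generalize Complex.I ^ (p - 1) = J at *
  generalize (-1 : ℂ) ^ (p - 1) = N at *
  rw [← h3] at hP ⊢
  have e1 : (1 - Complex.I) / t * (-J * X) * (-(t / s) * f ^ 2 * (N * (Y / f) * Z)) =
      (1 - Complex.I) / s * J * N * (X * Z) * (Y * f) := by
    field_simp
  rw [e1, hP, hX, show (1 - Complex.I) / s * J * N * 1 * (J * s ^ 2) =
    (1 - Complex.I) / s * (N * J ^ 2) * s ^ 2 by ring, hJ]
  field_simp

theorem exp_eq (p : ℕ) (hp : 2 ≤ p) : Complex.exp ((Real.pi : ℂ) * Complex.I *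
    (3 - (p : ℂ) ^ 2) / (2 * (p : ℂ))) = qh p ^ (3 - (p : ℤ) ^ 2) := by
  unfold qh
  rw [← Complex.exp_int_mul]
  congr 1
  push_cast
  ring

end LogHennings
open LogHennings in
/-- Evaluation of the right integral on the ribbon element and its inverse:
`μ(r) = δ` and `μ(r⁻¹) = δ⁻¹` with `δ = ((1-i)/√2) exp(iπ(3-p²)/(2p))`. -/
theorem mu_of_ribbon (p : ℕ) (hp : 2 ≤ p) :
    ∀ (μ : Uq p →ₗ[ℂ] ℂ) (ι : Uq p →ₐ[ℂ] Dq p), IsMu p μ → IsIota p ι →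
      ∀ rU rUinv : Uq p, ι rU = rib p → rU * rUinv = 1 → rUinv * rU = 1 →
        μ rU = ((1 - Complex.I) / (Real.sqrt 2 : ℂ)) *
            Complex.exp ((Real.pi : ℂ) * Complex.I * (3 - (p : ℂ) ^ 2) /
              (2 * (p : ℂ))) ∧
        μ rUinv = (((1 - Complex.I) / (Real.sqrt 2 : ℂ)) *
            Complex.exp ((Real.pi : ℂ) * Complex.I * (3 - (p : ℂ) ^ 2) /
              (2 * (p : ℂ))))⁻¹ := by
  intro μ ι hμ hι rU rUinv hr h12 h21
  obtain ⟨hrel, hE, hF, hK⟩ := U_rel p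
  set c : ℂ := (1 - Complex.I) / (2 * (Real.sqrt p : ℂ)) with hc
  set z : ℂ := -((Real.sqrt (2 / (p : ℝ)) : ℂ)) * (qfac p (p - 1)) ^ 2 with hz
  have hμ' : ∀ m j : ℕ, m < p → j < 2 * p → μ (UF p ^ m * UE p ^ m * UK p ^ j) =
      if m = p - 1 ∧ j = p + 1 then z else 0 := fun m j hm hj =>
    hrel.mu_FE (qq_ne_zero p) (qq_sub_ne p hp) hp hK μ z hμ m j hm hj
  have hrU : rU = ribA p c (UE p) (UF p) (UK p) := by
    apply iota_inj p hp ι hι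
    rw [hr]
    unfold ribA rib rc
    obtain ⟨i1, i2, i3, i4⟩ := hι
    simp only [map_smul, map_sum, map_mul, map_pow, i1, i2, i3, ← pow_mul]
    rfl
  have hm1 : μ rU = c * (rc p (p - 1) (p + 1) * z) := by
    rw [hrU]; exact mu_ribA hp μ z c hμ'
  have hv1 := val1 p hp
  have hv2 := val2 p hp
  rw [← hc, ← hz] at hv1 hv2
  have hc0 : c ≠ 0 := by
    rw [hc]
    refine div_ne_zero ?_ (mul_ne_zero two_ne_zero (sqrt_facts p hp).2.2.2.2)
    intro h
    have := congrArg Complex.re h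
    simp at this
  have hp0 : (2 * (p : ℂ)) ≠ 0 :=
    mul_ne_zero two_ne_zero (Nat.cast_ne_zero.2 (by omega))
  have hne : μ rU ≠ 0 := by
    intro h0
    rw [← hm1, h0, zero_mul] at hv2
    exact mul_ne_zero hc0 hp0 hv2.symm
  have hG : gaussG p ≠ 0 := by
    intro hG
    have h1 : rU * ∑ n ∈ Finset.range (2 * p), eK p (UK p) (n : ℤ) = 0 := by
      rw [Finset.mul_sum]
      refine Finset.sum_eq_zero fun n _ => ?_
      rw [hrU, ribA_eK hp hK, hG, mul_zero, zero_smul]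
    rw [sum_eK hp, mul_smul_comm, mul_one] at h1
    have h2 : rU = 0 := (smul_eq_zero.1 h1).resolve_left hp0
    exact hne (by rw [h2, map_zero])
  have hi : ribInv p (UE p) (UF p) (UK p) = (c * gaussG p * (2 * p)) • rUinv := by
    have h1 := ribInv_mul hrel hp hK hE c
    rw [← hrU] at h1
    have h2 := congrArg (· * rUinv) h1
    simpa only [mul_assoc, h12, mul_one, smul_mul_assoc, one_mul] using h2
  have hm2 := congrArg μ hi
  rw [mu_ribInv hp μ z hμ', map_smul, smul_eq_mul] at hm2
  have hprod : μ rU * μ rUinv = 1 := by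
    rw [← hm1] at hv2
    have h3 : (gaussG p * (c * (2 * p))) * (μ rU * μ rUinv) = (gaussG p * (c * (2 * p))) * 1 := by
      linear_combination gaussG p * hv2 - μ rU * hm2
    exact mul_left_cancel₀ (mul_ne_zero hG (mul_ne_zero hc0 hp0)) h3
  have hfin : μ rU = ((1 - Complex.I) / (Real.sqrt 2 : ℂ)) *
      Complex.exp ((Real.pi : ℂ) * Complex.I * (3 - (p : ℂ) ^ 2) / (2 * (p : ℂ))) := by
    rw [hm1, hv1, exp_eq p hp]
  refine ⟨hfin, ?_⟩
  rw [← hfin]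
  exact eq_inv_of_mul_eq_one_right hprod
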